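/- arXiv:1811.03587 — 6 statements merged into one kernel-verified Lean document; each statement's English description precedes it below -/
import Mathlib

section
/- For every r ∈ ℕ and every n ∈ ℕ, the Hermite-based tangent polynomials satisfy the addition formula _HT_n^{(r)}(x+u, y+v) = ∑_{k=0}^{n} C(n,k) · _HT_k^{(r)}(x,y) · H_{n−k}(u,v), as an identity of polynomials in x, y, u, v over ℝ. -/
open PowerSeries Finset

/-- The formal power series `e^{a t}`. -/
noncomputable def expX (a : ℝ) : PowerSeries ℝ :=
  PowerSeries.mk fun n => a ^ n / n.factorial

/-- The formal power series `e^{a t^2}`. -/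
noncomputable def expX2 (a : ℝ) : PowerSeries ℝ :=
  PowerSeries.mk fun n => if 2 ∣ n then a ^ (n / 2) / (n / 2).factorial else 0

/-- The formal power series `e^{x t + y t^2}`. -/
noncomputable def expH (x y : ℝ) : PowerSeries ℝ := expX x * expX2 y

theorem expX_eq_rescale_exp (a : ℝ) : expX a = rescale a (exp ℝ) := by
  ext n
  simp [expX, coeff_exp, div_eq_mul_inv]

theorem expX2_eq_expand (a : ℝ) : expX2 a = (expX a).expand 2 two_ne_zero := by
  ext n
  simp [expX2, expX, coeff_expand]

theorem expX_add (a b : ℝ) : expX (a + b) = expX a * expX b := by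
  simp only [expX_eq_rescale_exp, exp_mul_exp_eq_exp_add]

theorem expX2_add (a b : ℝ) : expX2 (a + b) = expX2 a * expX2 b := by
  simp only [expX2_eq_expand, expX_add, map_mul]

theorem expH_add (x y u v : ℝ) : expH (x + u) (y + v) = expH x y * expH u v := by
  simp only [expH, expX_add, expX2_add]
  ring

theorem expX_add_one_ne_zero (a : ℝ) : expX a + 1 ≠ 0 := by
  intro h
  have h0 := congrArg (coeff 0) h
  norm_num [expX] at h0

/-- The product of two exponential generating functions is that of the binomial convolution. -/
theorem eq_sum_choose_of_mk_div_factorial_eq_mul {a b c : ℕ → ℝ}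
    (h : (PowerSeries.mk fun n => a n / n.factorial) =
      (PowerSeries.mk fun n => b n / n.factorial) * PowerSeries.mk fun n => c n / n.factorial)
    (n : ℕ) : a n = ∑ k ∈ Finset.range (n + 1), (n.choose k : ℝ) * b k * c (n - k) := by
  have hn := congrArg (coeff n) h
  rw [coeff_mul, Finset.Nat.sum_antidiagonal_eq_sum_range_succ_mk] at hn
  simp only [coeff_mk] at hn
  rw [div_eq_iff (by positivity), Finset.sum_mul] at hn
  rw [hn]
  refine Finset.sum_congr rfl fun k hk => ?_
  rw [Nat.cast_choose ℝ (Nat.lt_succ_iff.mp (Finset.mem_range.mp hk))]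
  field_simp

/-- addition formula `_HT_n^{(r)}(x+u,y+v) = ∑ C(n,k) _HT_k^{(r)}(x,y) H_{n-k}(u,v)`. -/
theorem hermite_tangent_addition
    (H : ℕ → ℝ → ℝ → ℝ) (HT : ℕ → ℕ → ℝ → ℝ → ℝ)
    (hH : ∀ x y : ℝ, (PowerSeries.mk fun n => H n x y / n.factorial) = expH x y)
    (hHT : ∀ r : ℕ, ∀ x y : ℝ,
      (PowerSeries.mk fun n => HT r n x y / n.factorial) * (expX 2 + 1) ^ r = 2 ^ r * expH x y)
    (r n : ℕ) (x y u v : ℝ) :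
    HT r n (x + u) (y + v) =
      ∑ k ∈ Finset.range (n + 1), (n.choose k : ℝ) * HT r k x y * H (n - k) u v := by
  refine eq_sum_choose_of_mk_div_factorial_eq_mul (a := fun n => HT r n (x + u) (y + v))
    (b := fun n => HT r n x y) (c := fun n => H n u v) ?_ n
  apply mul_right_cancel₀ (pow_ne_zero r (expX_add_one_ne_zero 2))
  rw [hHT, mul_right_comm, hHT, hH, expH_add, mul_assoc]
end

section
/- For all r₁, r₂ ∈ ℕ and every n ∈ ℕ, the Hermite-based tangent polynomials satisfy _HT_n^{(r₁+r₂)}(x+u, y+v) = ∑_{k=0}^{n} C(n,k) · _HT_k^{(r₁)}(x,y) · _HT_{n−k}^{(r₂)}(u,v), as an identity of polynomials in x, y, u, v over ℝ. -/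
open PowerSeries Finset

theorem expX2_eq_expand_expX (a : ℝ) : expX2 a = expand 2 two_ne_zero (expX a) := by
  ext n
  simp [expX2, expX, coeff_expand]

/-- The coefficients of a product of exponential generating functions are binomial convolutions. -/
theorem factorial_mul_coeff_mk_mul_mk (f g : ℕ → ℝ) (n : ℕ) :
    (n.factorial : ℝ) * coeff n ((PowerSeries.mk fun k => f k / k.factorial) *
      (PowerSeries.mk fun k => g k / k.factorial)) =
      ∑ k ∈ Finset.range (n + 1), (n.choose k : ℝ) * f k * g (n - k) := by
  rw [coeff_mul, Finset.Nat.sum_antidiagonal_eq_sum_range_succ_mk, Finset.mul_sum]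
  refine Finset.sum_congr rfl fun k hk => ?_
  rw [Nat.cast_choose ℝ (Finset.mem_range_succ_iff.mp hk)]
  simp only [coeff_mk]
  field_simp

/-- `_HT_n^{(r₁+r₂)}(x+u,y+v) = ∑ C(n,k) _HT_k^{(r₁)}(x,y) _HT_{n-k}^{(r₂)}(u,v)`. -/
theorem hermite_tangent_order_addition
    (HT : ℕ → ℕ → ℝ → ℝ → ℝ)
    (hHT : ∀ r : ℕ, ∀ x y : ℝ,
      (PowerSeries.mk fun n => HT r n x y / n.factorial) * (expX 2 + 1) ^ r = 2 ^ r * expH x y)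
    (r₁ r₂ n : ℕ) (x y u v : ℝ) :
    HT (r₁ + r₂) n (x + u) (y + v) =
      ∑ k ∈ Finset.range (n + 1), (n.choose k : ℝ) * HT r₁ k x y * HT r₂ (n - k) u v := by
  have hmul : (PowerSeries.mk fun k => HT (r₁ + r₂) k (x + u) (y + v) / k.factorial) =
      (PowerSeries.mk fun k => HT r₁ k x y / k.factorial) *
        (PowerSeries.mk fun k => HT r₂ k u v / k.factorial) := by
    apply mul_right_cancel₀ (pow_ne_zero (r₁ + r₂) (expX_add_one_ne_zero 2))
    rw [hHT, expH_add, pow_add, pow_add, mul_mul_mul_comm, ← hHT, ← hHT, mul_mul_mul_comm]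
  rw [← factorial_mul_coeff_mk_mul_mk (fun k => HT r₁ k x y) (fun k => HT r₂ k u v), ← hmul,
    coeff_mk, mul_div_cancel₀ _ (Nat.cast_ne_zero.mpr n.factorial_ne_zero)]
end

section
/- For every r ∈ ℕ and every n ∈ ℕ, the Hermite-based tangent polynomials satisfy _HT_n^{(r)}(2(x+u), 2(y+v)) = ∑_{m=0}^{n} C(n,m) · _HT_{n−m}^{(r)}(x,y) · ∑_{p=0}^{m} C(m,p) · H_p(x,y) · H_{m−p}(2u,2v), as an identity of polynomials in x, y, u, v over ℝ. -/
open PowerSeries Finset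

theorem constantCoeff_expX (a : ℝ) : constantCoeff (expX a) = 1 := by
  simp [expX, ← coeff_zero_eq_constantCoeff_apply]

/-- The product of exponential generating functions is the exponential generating function of the
binomial convolution. -/
theorem mk_div_factorial_mul (a b : ℕ → ℝ) :
    (PowerSeries.mk fun n => a n / n.factorial) * (PowerSeries.mk fun n => b n / n.factorial) =
      PowerSeries.mk fun n =>
        (∑ k ∈ Finset.range (n + 1), (n.choose k : ℝ) * a k * b (n - k)) / n.factorial := by
  ext n
  simp only [coeff_mul, coeff_mk]
  rw [Finset.Nat.sum_antidiagonal_eq_sum_range_succ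
    (fun i j => a i / i.factorial * (b j / j.factorial)), Finset.sum_div]
  refine Finset.sum_congr rfl fun k hk => ?_
  rw [Nat.cast_choose ℝ (Finset.mem_range_succ_iff.mp hk)]
  field_simp

/-- `_HT_n^{(r)}(2(x+u),2(y+v))
    = ∑_m C(n,m) _HT_{n-m}^{(r)}(x,y) ∑_p C(m,p) H_p(x,y) H_{m-p}(2u,2v)`. -/
theorem hermite_tangent_double_argument
    (H : ℕ → ℝ → ℝ → ℝ) (HT : ℕ → ℕ → ℝ → ℝ → ℝ)
    (hH : ∀ x y : ℝ, (PowerSeries.mk fun n => H n x y / n.factorial) = expH x y)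
    (hHT : ∀ r : ℕ, ∀ x y : ℝ,
      (PowerSeries.mk fun n => HT r n x y / n.factorial) * (expX 2 + 1) ^ r = 2 ^ r * expH x y)
    (r n : ℕ) (x y u v : ℝ) :
    HT r n (2 * (x + u)) (2 * (y + v)) =
      ∑ m ∈ Finset.range (n + 1), (n.choose m : ℝ) * HT r (n - m) x y *
        ∑ p ∈ Finset.range (m + 1), (m.choose p : ℝ) * H p x y * H (m - p) (2 * u) (2 * v) := by
  have egf : (PowerSeries.mk fun n => HT r n (2 * (x + u)) (2 * (y + v)) / n.factorial) =
      (PowerSeries.mk fun n => H n x y / n.factorial) *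
        (PowerSeries.mk fun n => H n (2 * u) (2 * v) / n.factorial) *
          PowerSeries.mk fun n => HT r n x y / n.factorial := by
    apply mul_right_cancel₀ (pow_ne_zero r (expX_add_one_ne_zero 2))
    rw [hHT, mul_assoc, hHT, hH, hH,
      show 2 * (x + u) = x + (x + 2 * u) by ring, show 2 * (y + v) = y + (y + 2 * v) by ring,
      expH_add, expH_add]
    ring
  rw [mk_div_factorial_mul, mk_div_factorial_mul] at egf
  have h := congrArg (coeff n) egf
  simp only [coeff_mk] at h
  rw [div_left_inj' (by positivity)] at h
  rw [h]
  exact Finset.sum_congr rfl fun m _ => mul_right_comm _ _ _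
end

section
/- For every r ∈ ℕ and all n, m ∈ ℕ, the Hermite-based tangent polynomials satisfy the implicit summation formula _HT_{n+m}^{(r)}(v, y) = ∑_{p=0}^{n} ∑_{q=0}^{m} C(n,p) · C(m,q) · (v−x)^{p+q} · _HT_{n+m−p−q}^{(r)}(x,y), as an identity of polynomials in x, v, y over ℝ. -/
open PowerSeries Finset

/-- Multiplying an exponential generating function by `e^{d t}` is the binomial transform. -/
theorem binomial_transform_of_eq_expX_mul {a b : ℕ → ℝ} {d : ℝ}
    (h : (PowerSeries.mk fun n => b n / n.factorial) =
      expX d * PowerSeries.mk fun n => a n / n.factorial) (N : ℕ) :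
    b N = ∑ k ∈ Finset.range (N + 1), (N.choose k : ℝ) * d ^ k * a (N - k) := by
  have hN := congrArg (coeff N) h
  rw [coeff_mul, Finset.Nat.sum_antidiagonal_eq_sum_range_succ_mk] at hN
  simp only [expX, coeff_mk] at hN
  rw [div_eq_iff (by positivity), Finset.sum_mul] at hN
  rw [hN]
  refine Finset.sum_congr rfl fun k hk => ?_
  rw [Nat.cast_choose ℝ (Nat.lt_succ_iff.mp (Finset.mem_range.mp hk))]
  field_simp

/-- A binomial transform at index `n + m` splits into a double binomial sum. -/
theorem sum_choose_add_eq_sum_sum (a : ℕ → ℝ) (d : ℝ) (n m : ℕ) :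
    ∑ k ∈ Finset.range (n + m + 1), ((n + m).choose k : ℝ) * d ^ k * a (n + m - k) =
      ∑ p ∈ Finset.range (n + 1), ∑ q ∈ Finset.range (m + 1),
        (n.choose p : ℝ) * (m.choose q : ℝ) * d ^ (p + q) * a (n + m - p - q) := by
  let L : Polynomial ℝ →ₗ[ℝ] ℝ := Polynomial.lsum fun k => a k • LinearMap.id
  have hL (c : ℝ) (k : ℕ) : L (Polynomial.monomial k c) = c * a k := by
    simp [L, Polynomial.lsum_apply, Polynomial.sum_monomial_index, mul_comm]
  have hpow (N : ℕ) : (Polynomial.C d + Polynomial.X) ^ N =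
      ∑ k ∈ Finset.range (N + 1), Polynomial.monomial (N - k) ((N.choose k : ℝ) * d ^ k) := by
    rw [add_pow]
    refine Finset.sum_congr rfl fun k _ => ?_
    rw [← Polynomial.C_mul_X_pow_eq_monomial]
    simp only [map_mul, map_pow, map_natCast]
    ring
  have h := congrArg L (pow_add (Polynomial.C d + Polynomial.X) n m)
  rw [hpow, hpow, hpow, Finset.sum_mul_sum] at h
  simp only [map_sum, Polynomial.monomial_mul_monomial, hL] at h
  rw [h]
  refine Finset.sum_congr rfl fun p hp => Finset.sum_congr rfl fun q hq => ?_
  rw [Finset.mem_range] at hp hq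
  rw [show n - p + (m - q) = n + m - p - q by omega]
  ring

/-- implicit summation formula
    `_HT_{n+m}^{(r)}(v,y) = ∑_p ∑_q C(n,p) C(m,q) (v-x)^{p+q} _HT_{n+m-p-q}^{(r)}(x,y)`. -/
theorem hermite_tangent_implicit_summation
    (HT : ℕ → ℕ → ℝ → ℝ → ℝ)
    (hHT : ∀ r : ℕ, ∀ x y : ℝ,
      (PowerSeries.mk fun n => HT r n x y / n.factorial) * (expX 2 + 1) ^ r = 2 ^ r * expH x y)
    (r n m : ℕ) (x v y : ℝ) :
    HT r (n + m) v y =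
      ∑ p ∈ Finset.range (n + 1), ∑ q ∈ Finset.range (m + 1),
        (n.choose p : ℝ) * (m.choose q : ℝ) * (v - x) ^ (p + q) *
          HT r (n + m - p - q) x y := by
  have hgen : (PowerSeries.mk fun k => HT r k v y / k.factorial) =
      expX (v - x) * PowerSeries.mk fun k => HT r k x y / k.factorial := by
    apply mul_right_cancel₀ (pow_ne_zero r (expX_add_one_ne_zero 2))
    rw [mul_assoc, hHT, hHT, expH, expH, ← sub_add_cancel v x, expX_add, sub_add_cancel]
    ring
  rw [binomial_transform_of_eq_expX_mul hgen (n + m),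
    sum_choose_add_eq_sum_sum (fun k => HT r k x y)]
end

section
/- Let λ > 0 be a real number. For every r ∈ ℕ and every n ∈ ℕ, the modified degenerate Hermite-based tangent polynomials satisfy _HT_n^{(r)}(x,y:λ) = ∑_{k=0}^{n} C(n,k) · _HT_k^{(r)}(0,0:λ) · H_{n−k}(x,y:λ), for all real x, y. -/
open PowerSeries Finset

theorem expX_zero : expX 0 = 1 := by
  ext n
  rcases n with _ | n <;> simp [expX, PowerSeries.coeff_one]

theorem expX2_zero : expX2 0 = 1 := by
  ext n
  by_cases h : n = 0
  · simp [expX2, h]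
  · simp only [expX2, PowerSeries.coeff_mk, PowerSeries.coeff_one, if_neg h]
    split_ifs with h2
    · rw [zero_pow (by omega), zero_div]
    · rfl

theorem expH_zero : expH 0 0 = 1 := by
  rw [expH, expX_zero, expX2_zero, one_mul]

/-- A product of exponential generating functions corresponds to binomial convolution. -/
theorem eq_sum_choose_of_mk_eq_mul {a b c : ℕ → ℝ}
    (h : (PowerSeries.mk fun n => a n / n.factorial)
      = (PowerSeries.mk fun n => b n / n.factorial) *
          (PowerSeries.mk fun n => c n / n.factorial)) (n : ℕ) :
    a n = ∑ k ∈ Finset.range (n + 1), (n.choose k : ℝ) * b k * c (n - k) := by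
  have hn := congrArg (PowerSeries.coeff n) h
  rw [PowerSeries.coeff_mul, Finset.Nat.sum_antidiagonal_eq_sum_range_succ_mk] at hn
  simp only [PowerSeries.coeff_mk] at hn
  rw [div_eq_iff (by positivity), Finset.sum_mul] at hn
  rw [hn]
  refine Finset.sum_congr rfl fun k hk => ?_
  rw [Nat.cast_choose ℝ (Nat.lt_succ_iff.mp (Finset.mem_range.mp hk))]
  field_simp

/-- for λ > 0, `_HT_n^{(r)}(x,y:λ) = ∑_k C(n,k) _HT_k^{(r)}(0,0:λ) H_{n-k}(x,y:λ)`. -/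
theorem modified_degenerate_hermite_tangent_eq_sum
    (l : ℝ) (hl : 0 < l)
    (T : ℕ → ℕ → ℝ → ℝ → ℝ) (Hd : ℕ → ℝ → ℝ → ℝ)
    (hT : ∀ r : ℕ, ∀ x y : ℝ,
      (PowerSeries.mk fun n => T r n x y / n.factorial) *
          (expX (2 * Real.log (1 + l) / l) + 1) ^ r
        = 2 ^ r * expH (x * Real.log (1 + l) / l) (y * Real.log (1 + l) / l))
    (hH : ∀ x y : ℝ,
      (PowerSeries.mk fun n => Hd n x y / n.factorial)
        = expH (x * Real.log (1 + l) / l) (y * Real.log (1 + l) / l))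
    (r n : ℕ) (x y : ℝ) :
    T r n x y = ∑ k ∈ Finset.range (n + 1), (n.choose k : ℝ) * T r k 0 0 * Hd (n - k) x y := by
  refine eq_sum_choose_of_mk_eq_mul (a := fun k => T r k x y) (b := fun k => T r k 0 0)
    (c := fun k => Hd k x y) ?_ n
  apply mul_right_cancel₀ (pow_ne_zero r (expX_add_one_ne_zero (2 * Real.log (1 + l) / l)))
  have h0 := hT r 0 0
  simp only [zero_mul, zero_div, expH_zero, mul_one] at h0
  rw [hT, mul_right_comm, h0, hH]
end

section
/- Let λ > 0 be a real number. For every integer r ≥ 1 and every n ∈ ℕ, the modified degenerate Hermite-based tangent polynomials satisfy _HT_n^{(r)}(x+2, y:λ) + _HT_n^{(r)}(x, y:λ) = 2 · _HT_n^{(r−1)}(x, y:λ), for all real x, y. -/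
open PowerSeries Finset

theorem expX_eq_rescale (a : ℝ) : expX a = rescale a (PowerSeries.exp ℝ) := by
  ext n
  simp [expX, PowerSeries.coeff_exp, div_eq_mul_inv]

theorem expH_add_left (a x y : ℝ) : expH (x + a) y = expX a * expH x y := by
  simp only [expH, expX_add]
  ring

/-- for λ > 0 and r ≥ 1,
    `_HT_n^{(r)}(x+2,y:λ) + _HT_n^{(r)}(x,y:λ) = 2 _HT_n^{(r-1)}(x,y:λ)`. -/
theorem modified_degenerate_hermite_tangent_recurrence
    (l : ℝ) (hl : 0 < l)
    (T : ℕ → ℕ → ℝ → ℝ → ℝ)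
    (hT : ∀ r : ℕ, ∀ x y : ℝ,
      (PowerSeries.mk fun n => T r n x y / n.factorial) *
          (expX (2 * Real.log (1 + l) / l) + 1) ^ r
        = 2 ^ r * expH (x * Real.log (1 + l) / l) (y * Real.log (1 + l) / l))
    (r : ℕ) (hr : 1 ≤ r) (n : ℕ) (x y : ℝ) :
    T r n (x + 2) y + T r n x y = 2 * T (r - 1) n x y := by
  obtain ⟨k, rfl⟩ := Nat.exists_eq_add_of_le' hr
  have hshift : (x + 2) * Real.log (1 + l) / l
      = x * Real.log (1 + l) / l + 2 * Real.log (1 + l) / l := by ring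
  have h₁ := hT (k + 1) (x + 2) y
  rw [hshift, expH_add_left] at h₁
  have h₂ := hT (k + 1) x y
  have h₃ := hT k x y
  have key : (PowerSeries.mk fun n => T (k + 1) n (x + 2) y / n.factorial)
      + (PowerSeries.mk fun n => T (k + 1) n x y / n.factorial)
      = 2 * PowerSeries.mk fun n => T k n x y / n.factorial := by
    apply mul_right_cancel₀ (pow_ne_zero (k + 1) (expX_add_one_ne_zero (2 * Real.log (1 + l) / l)))
    linear_combination h₁ + h₂ - 2 * (expX (2 * Real.log (1 + l) / l) + 1) * h₃
  have hn := congrArg (PowerSeries.coeff n) key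
  have hfac : (n.factorial : ℝ) ≠ 0 := by positivity
  rw [two_mul] at hn
  simp only [map_add, PowerSeries.coeff_mk] at hn
  field_simp at hn
  rw [Nat.add_sub_cancel]
  linarith
end
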